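/- Let n ≥ 2 and let B ⊂ ℝ^{n+1} be a convex body. If all orthogonal projections of B onto linear hyperplanes are congruent to one another (for any two unit vectors u, v ∈ ℝ^{n+1} there is an isometry f of ℝ^{n+1} with f(B|u) = B|v, where B|v is the orthogonal projection of B onto v^⊥), then B is a closed Euclidean ball. -/

import Mathlib

open Metric
open scoped RealInnerProductSpace

section CompactGroup
open MeasureTheory

variable {G : Type*} [Group G] [TopologicalSpace G] [IsTopologicalGroup G] [CompactSpace G]

theorem hasCompactSupport_of_compactSpace {X : Type*} [TopologicalSpace X] [CompactSpace X]
    (F : X → ℝ) : HasCompactSupport F :=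
  (isClosed_tsupport F).isCompact

theorem exists_left_invariant_probability (G : Type*) [Group G] [TopologicalSpace G]
    [IsTopologicalGroup G] [CompactSpace G] [MeasurableSpace G] [BorelSpace G] :
    ∃ μ : Measure G, IsProbabilityMeasure μ ∧ μ.IsMulLeftInvariant ∧ μ.IsOpenPosMeasure :=
  ⟨Measure.haarMeasure ⊤, ⟨Measure.haarMeasure_self⟩, inferInstance, inferInstance⟩

theorem integral_average_subgroup [MeasurableSpace G] [BorelSpace G] (K : Subgroup G)
    [CompactSpace K] (μ : Measure G) [IsFiniteMeasure μ] [μ.IsMulRightInvariant]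
    (ν : Measure K) [IsProbabilityMeasure ν] {F : G → ℝ} (hF : Continuous F) :
    ∫ g, ∫ k : K, F (g * k) ∂ν ∂μ = ∫ g, F g ∂μ := by
  rw [integral_integral_swap_of_hasCompactSupport
    (by fun_prop) (hasCompactSupport_of_compactSpace _)]
  simp [integral_mul_right_eq_self]

end CompactGroup

section Orthogonal

variable {E : Type*} [NormedAddCommGroup E] [InnerProductSpace ℝ E] [FiniteDimensional ℝ E]

theorem compactSpace_unitary : CompactSpace (unitary (E →L[ℝ] E)) := by
  have : ProperSpace (E →L[ℝ] E) := FiniteDimensional.proper ℝ _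
  refine isCompact_iff_compactSpace.mp ?_
  refine (isCompact_closedBall (0 : E →L[ℝ] E) 1).of_isClosed_subset isClosed_unitary ?_
  intro g hg
  rw [mem_closedBall_zero_iff]
  refine g.opNorm_le_bound zero_le_one fun x => ?_
  rw [one_mul]
  exact ((Unitary.linearIsometryEquiv ⟨g, hg⟩).norm_map x).le

theorem norm_unitary_apply (g : unitary (E →L[ℝ] E)) (x : E) : ‖(g : E →L[ℝ] E) x‖ = ‖x‖ :=
  (Unitary.linearIsometryEquiv g).norm_map x

theorem inner_unitary_apply (g : unitary (E →L[ℝ] E)) (x y : E) :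
    ⟪(g : E →L[ℝ] E) x, (g : E →L[ℝ] E) y⟫ = ⟪x, y⟫ :=
  (Unitary.linearIsometryEquiv g).inner_map_map x y

theorem unitary_mul_apply (g k : unitary (E →L[ℝ] E)) (x : E) :
    ((g * k : unitary (E →L[ℝ] E)) : E →L[ℝ] E) x = (g : E →L[ℝ] E) ((k : E →L[ℝ] E) x) :=
  rfl

theorem unitary_inv_apply_apply (g : unitary (E →L[ℝ] E)) (x : E) :
    ((g⁻¹ : unitary (E →L[ℝ] E)) : E →L[ℝ] E) ((g : E →L[ℝ] E) x) = x := by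
  rw [← unitary_mul_apply, inv_mul_cancel]; rfl

theorem unitary_apply_inv_apply (g : unitary (E →L[ℝ] E)) (x : E) :
    (g : E →L[ℝ] E) (((g⁻¹ : unitary (E →L[ℝ] E)) : E →L[ℝ] E) x) = x := by
  rw [← unitary_mul_apply, mul_inv_cancel]; rfl

/-- Two vectors of equal norm are exchanged by an orthogonal map fixing every vector
orthogonal to both. -/
theorem exists_unitary_apply_eq {v w : E} (h : ‖v‖ = ‖w‖) :
    ∃ g : unitary (E →L[ℝ] E), (g : E →L[ℝ] E) v = w ∧
      ∀ x, ⟪x, v⟫ = 0 → ⟪x, w⟫ = 0 → (g : E →L[ℝ] E) x = x := by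
  refine ⟨Unitary.linearIsometryEquiv.symm ((ℝ ∙ (v - w))ᗮ.reflection),
    Submodule.reflection_sub h, fun x hv hw => ?_⟩
  refine Submodule.reflection_mem_subspace_eq_self ?_
  rw [Submodule.mem_orthogonal_singleton_iff_inner_left, inner_sub_right, hv, hw, sub_zero]

/-- The stabilizer of a vector in the orthogonal group. -/
def unitaryStabilizer (e : E) : Subgroup (unitary (E →L[ℝ] E)) where
  carrier := {g | (g : E →L[ℝ] E) e = e}
  mul_mem' {a b} ha hb := by
    simp only [Set.mem_ofPred_eq] at *
    rw [unitary_mul_apply, hb, ha]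
  one_mem' := rfl
  inv_mem' {a} ha := by
    simp only [Set.mem_ofPred_eq] at *
    conv_lhs => rw [← ha]
    exact unitary_inv_apply_apply a e

theorem continuous_unitary_apply (e : E) :
    Continuous fun g : unitary (E →L[ℝ] E) => (g : E →L[ℝ] E) e :=
  (ContinuousLinearMap.apply ℝ E e).continuous.comp continuous_subtype_val

theorem compactSpace_unitaryStabilizer (e : E) : CompactSpace (unitaryStabilizer e) := by
  have := compactSpace_unitary (E := E)
  refine isCompact_iff_compactSpace.mp ?_
  exact (isClosed_eq (continuous_unitary_apply e) continuous_const).isCompact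

end Orthogonal

section FunkTransform
open MeasureTheory

variable {E : Type*} [NormedAddCommGroup E] [InnerProductSpace ℝ E] [FiniteDimensional ℝ E]
  [MeasurableSpace (unitary (E →L[ℝ] E))] [BorelSpace (unitary (E →L[ℝ] E))]

/-- The mean of a function over a great subsphere does not depend on the subsphere. -/
theorem exists_integral_stabilizer_eq {φ : E → ℝ}
    (hφ : ∀ v v' : E, ‖v‖ = 1 → ‖v'‖ = 1 → ∃ ω : unitary (E →L[ℝ] E),
      (ω : E →L[ℝ] E) v = v' ∧ ∀ u, ⟪u, v⟫ = 0 → φ ((ω : E →L[ℝ] E) u) = φ u)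
    {e₀ e₁ : E} (h0 : ‖e₀‖ = 1) (h01 : ⟪e₁, e₀⟫ = 0)
    (ν : Measure (unitaryStabilizer e₀)) [ν.IsMulLeftInvariant] :
    ∃ C : ℝ, ∀ g : unitary (E →L[ℝ] E),
      ∫ k : unitaryStabilizer e₀, φ (((g * k : unitary (E →L[ℝ] E)) : E →L[ℝ] E) e₁) ∂ν = C := by
  refine ⟨∫ k : unitaryStabilizer e₀, φ (((k : unitary (E →L[ℝ] E)) : E →L[ℝ] E) e₁) ∂ν,
    fun g => ?_⟩
  obtain ⟨ω, hω, hωφ⟩ := hφ ((g : E →L[ℝ] E) e₀) e₀ (by rw [norm_unitary_apply, h0]) h0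
  have hk0 : ω * g ∈ unitaryStabilizer e₀ := hω
  rw [← integral_mul_left_eq_self (μ := ν) (fun k : unitaryStabilizer e₀ =>
    φ (((k : unitary (E →L[ℝ] E)) : E →L[ℝ] E) e₁)) ⟨ω * g, hk0⟩]
  refine integral_congr_ae (.of_forall fun k => ?_)
  have hk : ((k : unitary (E →L[ℝ] E)) : E →L[ℝ] E) e₀ = e₀ := k.2
  have := hωφ ((g : E →L[ℝ] E) (((k : unitary (E →L[ℝ] E)) : E →L[ℝ] E) e₁)) (by
    rw [inner_unitary_apply, ← h01]
    exact (congrArg _ hk.symm).trans (inner_unitary_apply _ _ _))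
  exact this.symm

theorem integral_sub_mul_eq_zero {φ : E → ℝ} (hφc : Continuous φ) {e₀ e₁ : E} {C : ℝ}
    (ν : Measure (unitaryStabilizer e₀)) [IsProbabilityMeasure ν]
    (hC : ∀ g : unitary (E →L[ℝ] E),
      ∫ k : unitaryStabilizer e₀, φ (((g * k : unitary (E →L[ℝ] E)) : E →L[ℝ] E) e₁) ∂ν = C)
    (μ : Measure (unitary (E →L[ℝ] E))) [IsFiniteMeasure μ] [μ.IsMulRightInvariant]
    {q : E → ℝ} (hq : Continuous q) :
    ∫ g, (φ ((g : E →L[ℝ] E) e₁) - C) * q ((g : E →L[ℝ] E) e₀) ∂μ = 0 := by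
  have := compactSpace_unitary (E := E)
  have := compactSpace_unitaryStabilizer e₀
  have h1 := continuous_unitary_apply (E := E) e₁
  have h0 := continuous_unitary_apply (E := E) e₀
  rw [← integral_average_subgroup (unitaryStabilizer e₀) μ ν (by fun_prop)]
  refine integral_eq_zero_of_ae (.of_forall fun g => ?_)
  have hk : ∀ k : unitaryStabilizer e₀,
      ((g * k : unitary (E →L[ℝ] E)) : E →L[ℝ] E) e₀ = (g : E →L[ℝ] E) e₀ := fun k =>
    congrArg (g : E →L[ℝ] E) k.2
  simp only [hk, integral_mul_const, Pi.zero_apply]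
  rw [integral_sub _ (integrable_const C), hC]
  · simp
  · refine Continuous.integrable_of_hasCompactSupport ?_ (hasCompactSupport_of_compactSpace _)
    exact hφc.comp (h1.comp (continuous_const.mul continuous_subtype_val))

/-- The mean of `⟪·, w⟫ ^ (2 * j)` over the great subsphere orthogonal to `g e₁`. -/
theorem integral_stabilizer_inner_pow {e₀ e₁ w : E} (h0 : ‖e₀‖ = 1) (h1 : ‖e₁‖ = 1)
    (h01 : ⟪e₀, e₁⟫ = 0) (hw : ‖w‖ = 1) (ν : Measure (unitaryStabilizer e₁))
    [ν.IsMulLeftInvariant] (g : unitary (E →L[ℝ] E)) (j : ℕ) :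
    ∫ k : unitaryStabilizer e₁,
        (⟪((g * k : unitary (E →L[ℝ] E)) : E →L[ℝ] E) e₀, w⟫ ^ 2) ^ j ∂ν =
      (1 - ⟪(g : E →L[ℝ] E) e₁, w⟫ ^ 2) ^ j *
        ∫ k : unitaryStabilizer e₁,
          (⟪((k : unitary (E →L[ℝ] E)) : E →L[ℝ] E) e₀, e₀⟫ ^ 2) ^ j ∂ν := by
  set w' := ((g⁻¹ : unitary (E →L[ℝ] E)) : E →L[ℝ] E) w with hw'
  set α := ⟪(g : E →L[ℝ] E) e₁, w⟫ with hα
  have hgw : (g : E →L[ℝ] E) w' = w := unitary_apply_inv_apply g w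
  have hα' : ⟪e₁, w'⟫ = α := by rw [hα, ← hgw, inner_unitary_apply]
  set β := w' - α • e₁ with hβ
  have hβ1 : ⟪e₁, β⟫ = 0 := by
    rw [hβ, inner_sub_right, inner_smul_right, hα', real_inner_self_eq_norm_sq, h1]; ring
  have hβn : ‖β‖ ^ 2 = 1 - α ^ 2 := by
    have hn : ‖w'‖ = 1 := by rw [← norm_unitary_apply g, hgw, hw]
    rw [hβ, norm_sub_sq_real, inner_smul_right, real_inner_comm, hα', norm_smul, hn, h1,
      Real.norm_eq_abs, mul_one, sq_abs]
    ring
  obtain ⟨κ, hκ, hκ'⟩ := exists_unitary_apply_eq (E := E) (v := ‖β‖ • e₀) (w := β)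
    (by rw [norm_smul, h0, norm_norm, mul_one])
  have hκ1 : κ ∈ unitaryStabilizer e₁ :=
    hκ' e₁ (by rw [inner_smul_right, real_inner_comm, h01, mul_zero]) hβ1
  rw [← integral_const_mul, ← integral_mul_left_eq_self (μ := ν) _ (⟨κ, hκ1⟩)]
  refine integral_congr_ae (.of_forall fun k => ?_)
  have hk1 : ((k : unitary (E →L[ℝ] E)) : E →L[ℝ] E) e₁ = e₁ := k.2
  have hκe : (κ : E →L[ℝ] E) e₁ = e₁ := hκ1
  set x := ((k : unitary (E →L[ℝ] E)) : E →L[ℝ] E) e₀ with hx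
  have hxe : ⟪(κ : E →L[ℝ] E) x, e₁⟫ = 0 := by
    rw [← h01]
    calc ⟪(κ : E →L[ℝ] E) x, e₁⟫ = ⟪(κ : E →L[ℝ] E) x, (κ : E →L[ℝ] E) e₁⟫ := by rw [hκe]
      _ = ⟪x, ((k : unitary (E →L[ℝ] E)) : E →L[ℝ] E) e₁⟫ := by rw [inner_unitary_apply, hk1]
      _ = _ := inner_unitary_apply _ _ _
  have key : ⟪(g : E →L[ℝ] E) ((κ : E →L[ℝ] E) x), w⟫ = ‖β‖ * ⟪x, e₀⟫ := by
    have hw'' : w' = β + α • e₁ := by rw [hβ]; abel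
    have hκx : ⟪(κ : E →L[ℝ] E) x, β⟫ = ‖β‖ * ⟪x, e₀⟫ :=
      (congrArg (fun y => ⟪(κ : E →L[ℝ] E) x, y⟫) hκ.symm).trans
        (by rw [inner_unitary_apply, inner_smul_right])
    rw [← hgw, inner_unitary_apply, hw'', inner_add_right, inner_smul_right, hxe, hκx]
    ring
  change (⟪(g : E →L[ℝ] E) ((κ : E →L[ℝ] E) x), w⟫ ^ 2) ^ j = (1 - α ^ 2) ^ j * (⟪x, e₀⟫ ^ 2) ^ j
  rw [key, mul_pow, hβn, mul_pow]

theorem integral_sub_mul_pow_eq_zero {φ : E → ℝ} (hφc : Continuous φ) {e₀ e₁ w : E} {C : ℝ}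
    (h0 : ‖e₀‖ = 1) (h1 : ‖e₁‖ = 1) (h01 : ⟪e₀, e₁⟫ = 0) (hw : ‖w‖ = 1)
    (μ : Measure (unitary (E →L[ℝ] E))) [IsFiniteMeasure μ] [μ.IsMulRightInvariant]
    (H : ∀ q : E → ℝ, Continuous q →
      ∫ g, (φ ((g : E →L[ℝ] E) e₁) - C) * q ((g : E →L[ℝ] E) e₀) ∂μ = 0) (j : ℕ) :
    ∫ g, (φ ((g : E →L[ℝ] E) e₁) - C) * (1 - ⟪(g : E →L[ℝ] E) e₁, w⟫ ^ 2) ^ j ∂μ = 0 := by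
  have := compactSpace_unitary (E := E)
  have := compactSpace_unitaryStabilizer e₁
  obtain ⟨ν, _, _, _⟩ := exists_left_invariant_probability (unitaryStabilizer e₁)
  have c1 := continuous_unitary_apply (E := E) e₁
  have c0 := continuous_unitary_apply (E := E) e₀
  have hH := H (fun x => (⟪x, w⟫ ^ 2) ^ j) (by fun_prop)
  rw [← integral_average_subgroup (unitaryStabilizer e₁) μ ν (by fun_prop)] at hH
  have hk : ∀ (g : unitary (E →L[ℝ] E)) (k : unitaryStabilizer e₁),
      ((g * k : unitary (E →L[ℝ] E)) : E →L[ℝ] E) e₁ = (g : E →L[ℝ] E) e₁ := fun g k =>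
    congrArg (g : E →L[ℝ] E) k.2
  simp only [hk, integral_const_mul, integral_stabilizer_inner_pow h0 h1 h01 hw,
    ← mul_assoc, integral_mul_const] at hH
  refine (mul_eq_zero.mp hH).resolve_right (ne_of_gt ?_)
  refine Continuous.integral_pos_of_hasCompactSupport_nonneg_nonzero (x := 1) ?_
    (hasCompactSupport_of_compactSpace _) (fun k => by positivity) ?_
  · have := c0.comp (continuous_subtype_val (p := (· ∈ unitaryStabilizer e₁)))
    exact ((this.inner continuous_const).pow 2).pow j
  · have : (((1 : unitaryStabilizer e₁) : unitary (E →L[ℝ] E)) : E →L[ℝ] E) e₀ = e₀ := rfl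
    rw [this, real_inner_self_eq_norm_sq, h0]
    simp

theorem integral_sub_mul_comp_eq_zero {X : Type*} [TopologicalSpace X] [CompactSpace X]
    [MeasurableSpace X] [BorelSpace X] (μ : Measure X) [IsFiniteMeasure μ] {ψ τ : X → ℝ}
    (hψ : Continuous ψ) (hτ : Continuous τ) (hτI : ∀ x, τ x ∈ Set.Icc (0 : ℝ) 1)
    (H : ∀ j : ℕ, ∫ x, ψ x * τ x ^ j ∂μ = 0) {χ : ℝ → ℝ} (hχ : Continuous χ) :
    ∫ x, ψ x * χ (τ x) ∂μ = 0 := by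
  have hint : ∀ F : X → ℝ, Continuous F → Integrable F μ := fun F hF =>
    hF.integrable_of_hasCompactSupport (hasCompactSupport_of_compactSpace F)
  have hp : ∀ p : Polynomial ℝ, ∫ x, ψ x * p.eval (τ x) ∂μ = 0 := by
    intro p
    simp only [Polynomial.eval_eq_sum_range, Finset.mul_sum]
    rw [integral_finsetSum _ fun i _ => hint _ (by fun_prop)]
    refine Finset.sum_eq_zero fun i _ => ?_
    simp only [mul_left_comm (ψ _), integral_const_mul, H, mul_zero]
  set M := ∫ x, |ψ x| ∂μ with hM
  have hM0 : 0 ≤ M := integral_nonneg fun x => abs_nonneg _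
  by_contra hne
  obtain ⟨p, hpχ⟩ := exists_polynomial_near_of_continuousOn 0 1 χ hχ.continuousOn
    (|∫ x, ψ x * χ (τ x) ∂μ| / (M + 1)) (by positivity)
  have h1 : |∫ x, ψ x * χ (τ x) ∂μ| ≤ M * (|∫ x, ψ x * χ (τ x) ∂μ| / (M + 1)) := by
    calc |∫ x, ψ x * χ (τ x) ∂μ| = |∫ x, ψ x * (χ (τ x) - p.eval (τ x)) ∂μ| := by
          simp only [mul_sub]
          rw [integral_sub (hint _ (by fun_prop)) (hint _ (by fun_prop)), hp, sub_zero]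
      _ ≤ ∫ x, |ψ x * (χ (τ x) - p.eval (τ x))| ∂μ := abs_integral_le_integral_abs
      _ ≤ ∫ x, |ψ x| * (|∫ x, ψ x * χ (τ x) ∂μ| / (M + 1)) ∂μ := by
          refine integral_mono (hint _ (by fun_prop)) (hint _ (by fun_prop)) fun x => ?_
          simp only [abs_mul]
          refine mul_le_mul_of_nonneg_left ?_ (abs_nonneg _)
          rw [abs_sub_comm]
          exact (hpχ _ (hτI x)).le
      _ = _ := by rw [integral_mul_const]
  have h2 : 0 < |∫ x, ψ x * χ (τ x) ∂μ| := abs_pos.mpr hne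
  rw [mul_div_assoc', le_div_iff₀ (by positivity)] at h1
  nlinarith

end FunkTransform

/-- An even continuous function whose restrictions to great subspheres are all congruent is
constant on the unit sphere. -/
theorem Function.Even.exists_eq_const_of_congruent_restrictions
    {E : Type*} [NormedAddCommGroup E] [InnerProductSpace ℝ E] [FiniteDimensional ℝ E]
    (hE : 2 ≤ Module.finrank ℝ E) {φ : E → ℝ} (heven : φ.Even) (hφc : Continuous φ)
    (hφ : ∀ v v' : E, ‖v‖ = 1 → ‖v'‖ = 1 → ∃ ω : unitary (E →L[ℝ] E),
      (ω : E →L[ℝ] E) v = v' ∧ ∀ u, ⟪u, v⟫ = 0 → φ ((ω : E →L[ℝ] E) u) = φ u) :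
    ∃ C : ℝ, ∀ w : E, ‖w‖ = 1 → φ w = C := by
  let _ : MeasurableSpace (unitary (E →L[ℝ] E)) := borel _
  have : BorelSpace (unitary (E →L[ℝ] E)) := ⟨rfl⟩
  have := compactSpace_unitary (E := E)
  obtain ⟨e₀, e₁, h0, h1, h01⟩ : ∃ e₀ e₁ : E, ‖e₀‖ = 1 ∧ ‖e₁‖ = 1 ∧ ⟪e₀, e₁⟫ = 0 := by
    have b := stdOrthonormalBasis ℝ E
    have hne : (⟨0, by lia⟩ : Fin (Module.finrank ℝ E)) ≠ ⟨1, by lia⟩ := by simp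
    exact ⟨b ⟨0, by lia⟩, b ⟨1, by lia⟩, b.norm_eq_one _, b.norm_eq_one _,
      b.orthonormal.inner_eq_zero hne⟩
  have := compactSpace_unitaryStabilizer e₀
  obtain ⟨ν, _, _, _⟩ := exists_left_invariant_probability (unitaryStabilizer e₀)
  obtain ⟨μ₀, _, _, _⟩ := exists_left_invariant_probability (unitary (E →L[ℝ] E))
  obtain ⟨C, hC⟩ := exists_integral_stabilizer_eq hφ h0 (by rw [real_inner_comm, h01]) ν
  refine ⟨C, fun w hw => ?_⟩
  have c1 := continuous_unitary_apply (E := E) e₁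
  have hτ : ∀ x : E, ‖x‖ = 1 → ⟪x, w⟫ ^ 2 ≤ 1 := fun x hx => by
    have := abs_real_inner_le_norm x w
    rw [hx, hw, mul_one] at this
    exact (sq_le_one_iff_abs_le_one _).mpr this
  have hg1 : ∀ g : unitary (E →L[ℝ] E), ‖(g : E →L[ℝ] E) e₁‖ = 1 := fun g => by
    rw [norm_unitary_apply, h1]
  have key : ∀ χ : ℝ → ℝ, Continuous χ →
      ∫ g, (φ ((g : E →L[ℝ] E) e₁) - C) * χ (1 - ⟪(g : E →L[ℝ] E) e₁, w⟫ ^ 2) ∂μ₀.inv = 0 := by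
    intro χ hχ
    refine integral_sub_mul_comp_eq_zero _ (by fun_prop) (by fun_prop)
      (fun g => ⟨?_, ?_⟩) (fun j => ?_) hχ
    · linarith [hτ _ (hg1 g)]
    · linarith [sq_nonneg ⟪(g : E →L[ℝ] E) e₁, w⟫]
    · exact integral_sub_mul_pow_eq_zero hφc h0 h1 h01 hw _
        (fun q hq => integral_sub_mul_eq_zero hφc ν hC _ hq) j
  by_contra hne
  have hne' : φ w - C ≠ 0 := sub_ne_zero.mpr hne
  have hpos : 0 < (φ w - C) * (φ w - C) := mul_self_pos.mpr hne'
  have hev : ∀ᶠ x in nhds w, 0 < (φ w - C) * (φ x - C) :=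
    (show ContinuousAt (fun x => (φ w - C) * (φ x - C)) w by fun_prop).eventually_const_lt hpos
  obtain ⟨η, hη, hball⟩ := Metric.eventually_nhds_iff_ball.mp hev
  have hnear : ∀ x : E, ‖x‖ = 1 → 1 - ⟪x, w⟫ ^ 2 < η ^ 2 / 2 → 0 < (φ w - C) * (φ x - C) := by
    have hn : ∀ x : E, ‖x‖ = 1 → 0 ≤ ⟪x, w⟫ → 1 - ⟪x, w⟫ ^ 2 < η ^ 2 / 2 →
        0 < (φ w - C) * (φ x - C) := by
      intro x hx hp hlt
      refine hball x ?_
      rw [mem_ball, dist_eq_norm]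
      refine lt_of_pow_lt_pow_left₀ 2 hη.le ?_
      rw [norm_sub_sq_real, hx, hw]
      nlinarith [hτ x hx]
    intro x hx hlt
    rcases le_total 0 ⟪x, w⟫ with hp | hp
    · exact hn x hx hp hlt
    · rw [← heven x]
      exact hn (-x) (by rwa [norm_neg]) (by rw [inner_neg_left]; linarith)
        (by rwa [inner_neg_left, neg_sq])
  have hint := key (fun s => max 0 (η ^ 2 / 2 - s)) (by fun_prop)
  obtain ⟨g0, hg0, -⟩ := exists_unitary_apply_eq (E := E) (h1.trans hw.symm)
  have hgt : 0 < ∫ g, (φ w - C) * ((φ ((g : E →L[ℝ] E) e₁) - C) *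
      max 0 (η ^ 2 / 2 - (1 - ⟪(g : E →L[ℝ] E) e₁, w⟫ ^ 2))) ∂μ₀.inv := by
    refine Continuous.integral_pos_of_hasCompactSupport_nonneg_nonzero (x := g0) (by fun_prop)
      (hasCompactSupport_of_compactSpace _) (fun g => ?_) ?_
    · rw [Pi.zero_apply, ← mul_assoc]
      rcases lt_or_ge (1 - ⟪(g : E →L[ℝ] E) e₁, w⟫ ^ 2) (η ^ 2 / 2) with h | h
      · exact mul_nonneg (hnear _ (hg1 g) h).le (le_max_left _ _)
      · rw [max_eq_left (by linarith), mul_zero]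
    · rw [hg0, real_inner_self_eq_norm_sq, hw, max_eq_right (by norm_num; positivity), ← mul_assoc]
      norm_num
      exact ⟨hne', hη.ne'⟩
  rw [MeasureTheory.integral_const_mul, hint, mul_zero] at hgt
  exact lt_irrefl _ hgt

section ConvexHull

variable {E : Type*} [NormedAddCommGroup E] [NormedSpace ℝ E]

theorem exists_isCompact_convexHull_finset_subset {s : Set E} (hs : IsCompact s) (k : ℕ) :
    ∃ C ⊆ convexHull ℝ s, IsCompact C ∧
      ∀ t : Finset E, t.card = k + 1 → ↑t ⊆ s → convexHull ℝ (t : Set E) ⊆ C := by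
  classical
  induction k with
  | zero =>
    refine ⟨s, subset_convexHull ℝ s, hs, fun t ht hts => ?_⟩
    obtain ⟨a, rfl⟩ := Finset.card_eq_one.mp ht
    simpa using hts
  | succ k ih =>
    obtain ⟨C, hCs, hC, ih⟩ := ih
    refine ⟨(fun p : ℝ × E × E => p.2.1 + p.1 • (p.2.2 - p.2.1)) '' Set.Icc 0 1 ×ˢ s ×ˢ C, ?_,
      (isCompact_Icc.prod (hs.prod hC)).image (by fun_prop), fun t ht hts => ?_⟩
    · rintro _ ⟨⟨a, x, y⟩, ⟨ha, hx, hy⟩, rfl⟩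
      exact (convex_convexHull ℝ s).add_smul_sub_mem (subset_convexHull ℝ s hx) (hCs hy) ha
    · obtain ⟨a, t, hat, rfl, htk⟩ := Finset.card_eq_succ.mp ht
      rw [Finset.coe_insert, Set.insert_subset_iff] at hts
      have hne : t.Nonempty := Finset.card_pos.mp (by lia)
      rw [Finset.coe_insert, convexHull_insert (by simpa using hne)]
      intro x hx
      rw [mem_convexJoin] at hx
      obtain ⟨a', rfl, y, hy, hxy⟩ := hx
      rw [segment_eq_image'] at hxy
      obtain ⟨θ, hθ, rfl⟩ := hxy
      exact ⟨(θ, a', y), ⟨hθ, hts.1, ih t htk hts.2 hy⟩, rfl⟩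

theorem IsCompact.convexHull_of_finiteDimensional [FiniteDimensional ℝ E] {s : Set E} (hs : IsCompact s) :
    IsCompact (convexHull ℝ s) := by
  choose C hCs hC hCt using exists_isCompact_convexHull_finset_subset hs
  have h : convexHull ℝ s = ⋃ k ∈ Finset.range (Module.finrank ℝ E + 1), C k := by
    refine subset_antisymm ?_ (Set.iUnion₂_subset fun k _ => hCs k)
    rw [convexHull_eq_union]
    refine Set.iUnion_subset fun t => Set.iUnion_subset fun hts => Set.iUnion_subset fun hti => ?_
    rcases t.eq_empty_or_nonempty with rfl | hne
    · simp
    have hcard := hti.card_le_finrank_succ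
    rw [Fintype.card_coe] at hcard
    have hpos := hne.card_pos
    have hle := (vectorSpan ℝ (Set.range ((↑) : t → E))).finrank_le
    refine (hCt (t.card - 1) t (by lia) hts).trans ?_
    exact Set.subset_biUnion_of_mem (u := C) (Finset.mem_coe.mpr (Finset.mem_range.mpr (by lia)))
  rw [h]
  exact (Finset.range _).finite_toSet.isCompact_biUnion fun k _ => hC k

end ConvexHull

section Circumball

variable {E : Type*} [NormedAddCommGroup E] [InnerProductSpace ℝ E]

/-- `closedBall c r` contains `K`, and its centre is a convex combination of the points of `K` at
distance `r`; this characterizes the smallest ball containing `K`. -/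
def IsCircumball (K : Set E) (c : E) (r : ℝ) : Prop :=
  K ⊆ closedBall c r ∧ c ∈ convexHull ℝ (K ∩ sphere c r)

theorem exists_minimal_closedBall [FiniteDimensional ℝ E] {K : Set E} (hK : IsCompact K) (hne : K.Nonempty) :
    ∃ (c : E) (r : ℝ), K ⊆ closedBall c r ∧ ∀ c' r', K ⊆ closedBall c' r' → r ≤ r' := by
  obtain ⟨k, hk⟩ := hne
  obtain ⟨D, hD⟩ := hK.isBounded.subset_closedBall k
  have hD0 : 0 ≤ D := by simpa using hD hk
  let P : Set (E × ℝ) := (closedBall k D ×ˢ Set.Icc 0 D) ∩ {p | ∀ x ∈ K, dist x p.1 ≤ p.2}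
  have hP : IsCompact P := by
    refine ((isCompact_closedBall k D).prod isCompact_Icc).inter_right ?_
    simp only [Set.ofPred_forall]
    exact isClosed_biInter fun x _ => isClosed_le (by fun_prop) (by fun_prop)
  obtain ⟨⟨c, r⟩, ⟨-, hr⟩, hmin⟩ := hP.exists_isMinOn
    ⟨(k, D), ⟨mem_closedBall_self hD0, hD0, le_rfl⟩, hD⟩ continuous_snd.continuousOn
  refine ⟨c, r, hr, fun c' r' h => ?_⟩
  have hk' : dist k c' ≤ r' := h hk
  have hrD : r ≤ D := hmin (a := (k, D)) ⟨⟨mem_closedBall_self hD0, hD0, le_rfl⟩, hD⟩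
  rcases le_total r' D with hle | hle
  · exact hmin (a := (c', r'))
      ⟨⟨by rw [mem_closedBall, dist_comm]; exact hk'.trans hle, dist_nonneg.trans hk', hle⟩, h⟩
  · exact hrD.trans hle

theorem exists_isCircumball [FiniteDimensional ℝ E] {K : Set E} (hK : IsCompact K)
    (hne : K.Nonempty) :
    ∃ (c : E) (r : ℝ), IsCircumball K c r := by
  obtain ⟨c, r, hKr, hmin⟩ := exists_minimal_closedBall hK hne
  refine ⟨c, r, hKr, ?_⟩
  by_contra hc
  obtain ⟨f, u, hu, hf⟩ := geometric_hahn_banach_point_closed (convex_convexHull ℝ _)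
    (hK.inter_right isClosed_sphere).convexHull_of_finiteDimensional.isClosed hc
  set d := (InnerProductSpace.toDual ℝ E).symm f with hd
  have hfd : ∀ x, f x = ⟪x, d⟫ := fun x => by
    rw [real_inner_comm, hd, InnerProductSpace.toDual_symm_apply]
  have hr0 : 0 ≤ r := by
    obtain ⟨k, hk⟩ := hne
    exact dist_nonneg.trans (hKr hk)
  have hxr : ∀ x ∈ K, ‖x - c‖ ≤ r := fun x hx => by rw [← dist_eq_norm]; exact hKr hx
  obtain ⟨y, hy, hym⟩ := hK.exists_isMinOn hne
    (f := fun x => max (r ^ 2 - ‖x - c‖ ^ 2) ⟪x - c, d⟫) (by fun_prop)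
  set m := max (r ^ 2 - ‖y - c‖ ^ 2) ⟪y - c, d⟫ with hm
  have hm0 : 0 < m := by
    rcases (hxr y hy).lt_or_eq with h | h
    · exact lt_max_of_lt_left (by nlinarith [norm_nonneg (y - c)])
    · refine lt_max_of_lt_right ?_
      have := hf y (subset_convexHull ℝ _ ⟨hy, by rw [mem_sphere, dist_eq_norm, h]⟩)
      rw [inner_sub_left, ← hfd, ← hfd]
      linarith
  set Q := 2 * r * ‖d‖ + ‖d‖ ^ 2 + 1 with hQ
  have hQ0 : 0 < Q := by positivity
  set ε := min 1 (m / 2 / Q) with hε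
  have hε0 : 0 < ε := lt_min one_pos (by positivity)
  have hε1 : ε ≤ 1 := min_le_left _ _
  have hεQ : ε * Q ≤ m / 2 := (le_div_iff₀ hQ0).mp (min_le_right _ _)
  have hsq : ∀ x ∈ K, ‖x - (c + ε • d)‖ ^ 2 ≤ r ^ 2 - ε * m / 2 := by
    intro x hx
    have hmx : m ≤ max (r ^ 2 - ‖x - c‖ ^ 2) ⟪x - c, d⟫ := hym hx
    have hx2 : ‖x - c‖ ^ 2 ≤ r ^ 2 := by
      have := hxr x hx
      gcongr
    have hin : -(r * ‖d‖) ≤ ⟪x - c, d⟫ := by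
      have h1 := abs_real_inner_le_norm (x - c) d
      have h2 := mul_le_mul_of_nonneg_right (hxr x hx) (norm_nonneg d)
      linarith [neg_abs_le ⟪x - c, d⟫]
    rw [← sub_sub, norm_sub_sq_real, inner_smul_right, norm_smul, mul_pow, Real.norm_eq_abs,
      sq_abs]
    have h3 : ε * ‖d‖ ^ 2 + ε * (2 * r * ‖d‖) ≤ m / 2 := by linarith
    have h4 : 0 ≤ ε * (2 * r * ‖d‖) := by positivity
    have h6 : ε ^ 2 * ‖d‖ ^ 2 ≤ ε * (ε * ‖d‖ ^ 2) := by rw [sq, mul_assoc]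
    rcases le_max_iff.mp hmx with h | h
    · have h5 : ε ^ 2 * ‖d‖ ^ 2 ≤ ε * ‖d‖ ^ 2 := by
        have : ε ^ 2 ≤ ε := by nlinarith
        gcongr
      have h7 := mul_le_mul_of_nonneg_left hin hε0.le
      nlinarith
    · have h5 := mul_le_mul_of_nonneg_left h hε0.le
      have h7 : ε * (ε * ‖d‖ ^ 2) ≤ ε * (m / 2) := by gcongr; linarith
      nlinarith
  have hle := hmin (c + ε • d) (√(r ^ 2 - ε * m / 2)) fun x hx => by
    rw [mem_closedBall, dist_eq_norm]
    exact Real.le_sqrt_of_sq_le (hsq x hx)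
  have hnn : 0 ≤ r ^ 2 - ε * m / 2 := (sq_nonneg _).trans (hsq y hy)
  have := (Real.le_sqrt hr0 hnn).mp hle
  nlinarith [mul_pos hε0 hm0]

theorem IsCircumball.eq_of_subset_closedBall {K : Set E} {c c' : E} {r r' : ℝ}
    (h : IsCircumball K c r) (h' : K ⊆ closedBall c' r') (hr : r' ≤ r) : c' = c := by
  have hT : Convex ℝ {x : E | ⟪x, c - c'⟫ ≤ (‖c‖ ^ 2 - ‖c'‖ ^ 2) / 2} := by
    have := convex_halfSpace_le (𝕜 := ℝ) (f := fun x : E => ⟪x, c - c'⟫)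
      ⟨fun x y => inner_add_left _ _ _, fun a x => by simp [inner_smul_left]⟩
      ((‖c‖ ^ 2 - ‖c'‖ ^ 2) / 2)
    exact this
  have hc := convexHull_min (fun x hx => ?_) hT h.2
  · have h2 : ‖c - c'‖ ^ 2 ≤ 0 := by
      rw [Set.mem_ofPred_eq, inner_sub_right, real_inner_self_eq_norm_sq] at hc
      rw [norm_sub_sq_real]
      linarith
    have h3 : ‖c - c'‖ = 0 := by nlinarith [norm_nonneg (c - c')]
    exact (sub_eq_zero.mp (norm_eq_zero.mp h3)).symm
  · have h1 : ‖x - c'‖ ≤ r' := by rw [← dist_eq_norm]; exact h' hx.1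
    have h2 : ‖x - c‖ = r := by rw [← dist_eq_norm]; exact hx.2
    have h3 : ‖x - c'‖ ^ 2 ≤ ‖x - c‖ ^ 2 := by
      rw [h2]
      have := h1.trans hr
      gcongr
    rw [norm_sub_sq_real, norm_sub_sq_real] at h3
    rw [Set.mem_ofPred_eq, inner_sub_right]
    linarith

theorem IsCircumball.unique {K : Set E} {c c' : E} {r r' : ℝ} (h : IsCircumball K c r)
    (h' : IsCircumball K c' r') : c = c' ∧ r = r' := by
  have aux : ∀ {c c' : E} {r r' : ℝ}, IsCircumball K c r → IsCircumball K c' r' → r' ≤ r →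
      c = c' ∧ r = r' := by
    intro c c' r r' h h' hr
    obtain rfl := h.eq_of_subset_closedBall h'.1 hr
    obtain ⟨x, hxK, hx⟩ : (K ∩ sphere c' r).Nonempty := convexHull_nonempty_iff.mp ⟨_, h.2⟩
    refine ⟨rfl, le_antisymm ?_ hr⟩
    rw [mem_sphere] at hx
    rw [← hx]
    exact h'.1 hxK
  rcases le_total r' r with hr | hr
  · exact aux h h' hr
  · exact (aux h' h hr).imp Eq.symm Eq.symm

theorem IsCircumball.image {K : Set E} {c : E} {r : ℝ} (h : IsCircumball K c r) (f : E ≃ᵢ E) :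
    IsCircumball (f '' K) (f c) r := by
  refine ⟨?_, ?_⟩
  · rintro _ ⟨x, hx, rfl⟩
    rw [mem_closedBall, f.isometry.dist_eq]
    exact h.1 hx
  · have himg : f '' (K ∩ sphere c r) = f '' K ∩ sphere (f c) r := by
      rw [Set.image_inter f.injective, f.image_sphere]
    rw [← himg]
    have := AffineMap.image_convexHull (f := f.toRealAffineIsometryEquiv.toAffineEquiv.toAffineMap)
      (s := K ∩ sphere c r)
    have hcoe : ⇑(f.toRealAffineIsometryEquiv.toAffineEquiv.toAffineMap) = f := by
      ext; simp
    rw [hcoe] at this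
    rw [← this]
    exact ⟨c, h.2, rfl⟩

end Circumball

section Projections

variable {E : Type*} [NormedAddCommGroup E] [InnerProductSpace ℝ E]

/-- For a unit vector `v`, the orthogonal projection of `x` onto the hyperplane `v^⊥`. -/
def hyperplaneProj (v x : E) : E := x - ⟪x, v⟫ • v

theorem hyperplaneProj_neg (v : E) : hyperplaneProj (-v) = hyperplaneProj v := by
  ext x; simp [hyperplaneProj, inner_neg_right]

theorem hyperplaneProj_add (v x y : E) :
    hyperplaneProj v (x + y) = hyperplaneProj v x + hyperplaneProj v y := by
  simp only [hyperplaneProj, inner_add_left]; module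

theorem hyperplaneProj_sub (v x y : E) :
    hyperplaneProj v (x - y) = hyperplaneProj v x - hyperplaneProj v y := by
  simp only [hyperplaneProj, inner_sub_left]; module

theorem hyperplaneProj_of_inner_eq_zero {v x : E} (h : ⟪x, v⟫ = 0) : hyperplaneProj v x = x := by
  simp [hyperplaneProj, h]

theorem inner_hyperplaneProj_self {v : E} (hv : ‖v‖ = 1) (x : E) :
    ⟪hyperplaneProj v x, v⟫ = 0 := by
  rw [hyperplaneProj, inner_sub_left, inner_smul_left, real_inner_self_eq_norm_sq, hv]
  simp

theorem inner_hyperplaneProj_comm (v x y : E) :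
    ⟪hyperplaneProj v x, y⟫ = ⟪x, hyperplaneProj v y⟫ := by
  simp only [hyperplaneProj, inner_sub_left, inner_sub_right, inner_smul_left, inner_smul_right,
    real_inner_comm y v, RCLike.conj_to_real]
  ring

theorem norm_hyperplaneProj_sq {v : E} (hv : ‖v‖ = 1) (x : E) :
    ‖hyperplaneProj v x‖ ^ 2 = ‖x‖ ^ 2 - ⟪x, v⟫ ^ 2 := by
  rw [hyperplaneProj, norm_sub_sq_real, inner_smul_right, norm_smul, hv, Real.norm_eq_abs,
    mul_one, sq_abs]
  ring

theorem norm_hyperplaneProj_le {v : E} (hv : ‖v‖ = 1) (x : E) : ‖hyperplaneProj v x‖ ≤ ‖x‖ := by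
  refine le_of_sq_le_sq ?_ (norm_nonneg _)
  rw [norm_hyperplaneProj_sq hv]
  linarith [sq_nonneg ⟪x, v⟫]

/-- Points `c + u i + ζ i • v` of `B` whose projections along `v` witness that `c` is the centre of
the circumball, of radius `R`, of the projection of `B`. -/
structure IsContactSystem {ι : Type*} [Fintype ι] (B : Set E) (v c : E) (R : ℝ) (u : ι → E)
    (ζ w : ι → ℝ) : Prop where
  mem : ∀ i, c + u i + ζ i • v ∈ B
  norm_eq : ∀ i, ‖u i‖ = R
  inner_eq : ∀ i, ⟪u i, v⟫ = 0
  inner_center : ⟪c, v⟫ = 0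
  pos : ∀ i, 0 < w i
  sum_eq_one : ∑ i, w i = 1
  sum_smul : ∑ i, w i • u i = 0
  unique : ∀ β : ι → ℝ, ∑ i, β i • u i = 0 → ∃ S, ∀ i, β i = S * w i

theorem IsCircumball.inner_center {B : Set E} {v c : E} {R : ℝ} (hv : ‖v‖ = 1)
    (h : IsCircumball (hyperplaneProj v '' B) c R) : ⟪c, v⟫ = 0 := by
  have hconv : Convex ℝ {x : E | ⟪x, v⟫ = 0} :=
    convex_hyperplane (𝕜 := ℝ) (f := fun x : E => ⟪x, v⟫)
      ⟨fun x y => inner_add_left _ _ _, fun a x => by simp [inner_smul_left]⟩ 0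
  refine convexHull_min ?_ hconv h.2
  rintro _ ⟨⟨b, -, rfl⟩, -⟩
  exact inner_hyperplaneProj_self hv b

theorem IsCircumball.exists_isContactSystem.{u} {E : Type u} [NormedAddCommGroup E]
    [InnerProductSpace ℝ E] {B : Set E} {v c : E} {R : ℝ} (hv : ‖v‖ = 1)
    (h : IsCircumball (hyperplaneProj v '' B) c R) :
    ∃ (ι : Type u) (_ : Fintype ι) (u : ι → E) (ζ w : ι → ℝ), IsContactSystem B v c R u ζ w := by
  have hc := h.inner_center hv
  obtain ⟨ι, _, z, w, hz, hind, hw, hw1, hwz⟩ := eq_pos_convex_span_of_mem_convexHull h.2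
  have hzi : ∀ i, ∃ b ∈ B, hyperplaneProj v b = z i := fun i => (hz ⟨i, rfl⟩).1
  choose b hb hbz using hzi
  have hsum : ∀ γ : ι → ℝ, ∑ i, γ i • (z i - c) = ∑ i, γ i • z i - (∑ i, γ i) • c := fun γ => by
    simp only [smul_sub, Finset.sum_sub_distrib, Finset.sum_smul]
  refine ⟨ι, inferInstance, fun i => z i - c, fun i => ⟪b i, v⟫, w, fun i => ?_, fun i => ?_,
    fun i => ?_, hc, hw, hw1, ?_, fun β hβ => ⟨∑ i, β i, fun i => ?_⟩⟩
  · convert hb i using 1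
    rw [← hbz i, hyperplaneProj]
    abel
  · rw [← dist_eq_norm]
    exact (hz ⟨i, rfl⟩).2
  · rw [inner_sub_left, hc, ← hbz i, inner_hyperplaneProj_self hv, sub_zero]
  · rw [hsum, hwz, hw1, one_smul, sub_self]
  · have := (affineIndependent_iff.mp hind) Finset.univ (fun i => β i - (∑ j, β j) * w i)
      (by rw [Finset.sum_sub_distrib, ← Finset.mul_sum, hw1]; ring)
      (by
        rw [hsum, sub_eq_zero] at hβ
        simp only [sub_smul, Finset.sum_sub_distrib, mul_smul, ← Finset.smul_sum, hwz, hβ,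
          sub_self]) i (Finset.mem_univ i)
    linarith

variable {B : Set E} {R : ℝ} {c : E → E}

theorem norm_inv_norm_smul {x : E} (hx : x ≠ 0) : ‖‖x‖⁻¹ • x‖ = 1 := by
  rw [norm_smul, norm_inv, norm_norm, inv_mul_cancel₀ (norm_ne_zero_iff.mpr hx)]

theorem exists_unit_inner_eq_zero_of_pair {v w : E} (hv : ‖v‖ = 1) (hw : w ≠ 0) (hvw : ⟪w, v⟫ = 0)
    (z : E) : ∃ v' : E, ‖v'‖ = 1 ∧ ⟪z, v'⟫ = 0 ∧
      ∀ u : E, ⟪u, v⟫ = 0 → ⟪u, w⟫ = 0 → ⟪u, v'⟫ = 0 := by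
  by_cases hz : ⟪z, v⟫ = 0
  · exact ⟨v, hv, hz, fun u hu _ => hu⟩
  set t := ⟪z, w⟫ • v - ⟪z, v⟫ • w with ht
  have ht0 : t ≠ 0 := by
    intro h0
    have h1 : ⟪w, t⟫ = 0 := by rw [h0, inner_zero_right]
    rw [ht, inner_sub_right, inner_smul_right, inner_smul_right, hvw, mul_zero, zero_sub,
      neg_eq_zero, mul_eq_zero, inner_self_eq_zero] at h1
    exact h1.elim hz hw
  refine ⟨‖t‖⁻¹ • t, norm_inv_norm_smul ht0, ?_, fun u hu hu' => ?_⟩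
  · rw [inner_smul_right, ht, inner_sub_right, inner_smul_right, inner_smul_right]
    ring
  · rw [inner_smul_right, ht, inner_sub_right, inner_smul_right, inner_smul_right, hu, hu']
    ring

theorem IsContactSystem.center_eq {ι : Type*} [Fintype ι] {v c₀ : E} {u : ι → E} {ζ w : ι → ℝ}
    (hs : IsContactSystem B v c₀ R u ζ w) {v' c' : E}
    (h : hyperplaneProj v' '' B ⊆ closedBall c' R) (hu : ∀ i, ⟪u i, v'⟫ = 0) (i₀ : ι) :
    c' = hyperplaneProj v' (c₀ + ζ i₀ • v) := by
  set e : ι → E := fun i => hyperplaneProj v' (c₀ + ζ i • v) - c' with he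
  have h1 : ∀ i, 2 * ⟪u i, e i⟫ + ‖e i‖ ^ 2 ≤ 0 := by
    intro i
    have h2 := h ⟨_, hs.mem i, rfl⟩
    have h3 : c₀ + u i + ζ i • v = u i + (c₀ + ζ i • v) := by abel
    rw [mem_closedBall, dist_eq_norm, h3, hyperplaneProj_add,
      hyperplaneProj_of_inner_eq_zero (hu i), add_sub_assoc] at h2
    have h4 : ‖u i + e i‖ ^ 2 ≤ R ^ 2 := by gcongr
    rw [norm_add_sq_real, hs.norm_eq] at h4
    linarith
  have h2 : ∀ i, ⟪u i, e i⟫ = ⟪u i, c₀ - c'⟫ := fun i => by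
    rw [he, inner_sub_right, ← inner_hyperplaneProj_comm, hyperplaneProj_of_inner_eq_zero (hu i),
      inner_add_right, inner_smul_right, hs.inner_eq, inner_sub_right]
    ring
  have h3 : ∑ i, w i * ⟪u i, e i⟫ = 0 := by
    simp only [h2, ← real_inner_smul_left, ← sum_inner, hs.sum_smul, inner_zero_left]
  have h4 : ∑ i, w i * ‖e i‖ ^ 2 ≤ 0 := by
    have : ∑ i, w i * (2 * ⟪u i, e i⟫ + ‖e i‖ ^ 2) ≤ 0 :=
      Finset.sum_nonpos fun i _ => mul_nonpos_of_nonneg_of_nonpos (hs.pos i).le (h1 i)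
    simp only [mul_add, Finset.sum_add_distrib, mul_left_comm (w _) 2, ← Finset.mul_sum, h3] at this
    linarith
  have hnn : ∀ i ∈ Finset.univ, 0 ≤ w i * ‖e i‖ ^ 2 := fun i _ =>
    mul_nonneg (hs.pos i).le (sq_nonneg _)
  have h5 := (Finset.sum_eq_zero_iff_of_nonneg hnn).mp
    (le_antisymm h4 (Finset.sum_nonneg hnn)) i₀ (Finset.mem_univ _)
  have h6 : e i₀ = 0 := by
    simpa [(hs.pos i₀).ne'] using h5
  exact (sub_eq_zero.mp h6).symm

theorem IsContactSystem.nonempty {ι : Type*} [Fintype ι] {v c₀ : E} {u : ι → E} {ζ w : ι → ℝ}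
    (hs : IsContactSystem B v c₀ R u ζ w) : Nonempty ι := by
  by_contra hι
  rw [not_nonempty_iff] at hι
  simpa using hs.sum_eq_one

theorem IsContactSystem.exists_center {ι : Type*} [Fintype ι] {v : E} {u : ι → E} {ζ w : ι → ℝ}
    (hv : ‖v‖ = 1) (hs : IsContactSystem B v (c v) R u ζ w)
    (hc : ∀ v, ‖v‖ = 1 → IsCircumball (hyperplaneProj v '' B) (c v) R)
    {y : E} (hy : y ≠ 0) (hyv : ⟪y, v⟫ = 0) (hyu : ∀ i, ⟪u i, y⟫ = 0) :
    ∃ a : E, ∀ v, ‖v‖ = 1 → c v = hyperplaneProj v a := by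
  obtain ⟨i₀⟩ := hs.nonempty
  refine ⟨c v + ζ i₀ • v, fun v₁ hv₁ => ?_⟩
  have hB : ∀ b ∈ B, ‖b - (c v + ζ i₀ • v)‖ ≤ R := by
    intro b hb
    obtain ⟨v', hv', hz, hv'u⟩ :=
      exists_unit_inner_eq_zero_of_pair hv hy hyv (b - (c v + ζ i₀ • v))
    have h1 := hs.center_eq (hc v' hv').1 (fun i => hv'u _ (hs.inner_eq i) (hyu i)) i₀
    have h2 := (hc v' hv').1 ⟨b, hb, rfl⟩
    rwa [mem_closedBall, dist_eq_norm, h1, ← hyperplaneProj_sub,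
      hyperplaneProj_of_inner_eq_zero hz] at h2
  refine ((hc v₁ hv₁).eq_of_subset_closedBall (r' := R) ?_ le_rfl).symm
  rintro _ ⟨b, hb, rfl⟩
  rw [mem_closedBall, dist_eq_norm, ← hyperplaneProj_sub]
  exact (norm_hyperplaneProj_le hv₁ _).trans (hB b hb)

end Projections

section Nondegenerate

variable {E : Type*} [NormedAddCommGroup E] [InnerProductSpace ℝ E] {B : Set E} {R : ℝ}
  {ι : Type*} [Fintype ι] {v c₀ : E} {u : ι → E} {ζ w : ι → ℝ}

theorem norm_smul_add_smul_eq_one {v a : E} (hv : ‖v‖ = 1) (ha : ‖a‖ = 1) (hva : ⟪a, v⟫ = 0)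
    {p q : ℝ} (hpq : p ^ 2 + q ^ 2 = 1) : ‖p • v + q • a‖ = 1 := by
  have : ‖p • v + q • a‖ ^ 2 = 1 := by
    rw [norm_add_sq_real, inner_smul_left, inner_smul_right, real_inner_comm, hva, norm_smul,
      norm_smul, hv, ha, Real.norm_eq_abs, Real.norm_eq_abs, mul_one, mul_one, sq_abs, sq_abs]
    simpa using hpq
  nlinarith [norm_nonneg (p • v + q • a)]

theorem IsContactSystem.sum_mul_inner (hs : IsContactSystem B v c₀ R u ζ w) (y : E) :
    ∑ i, w i * ⟪u i, y⟫ = 0 := by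
  simp only [← real_inner_smul_left, ← sum_inner, hs.sum_smul, inner_zero_left]

theorem IsContactSystem.inner_rotate_le (hs : IsContactSystem B v c₀ R u ζ w) (hv : ‖v‖ = 1)
    {a : E} (ha : ‖a‖ = 1) (hva : ⟪a, v⟫ = 0) {p q : ℝ} (hpq : p ^ 2 + q ^ 2 = 1) {c' : E}
    (h : hyperplaneProj (p • v + q • a) '' B ⊆ closedBall c' R) (hc' : ⟪c', p • v + q • a⟫ = 0)
    (i : ι) :
    2 * ⟪u i, hyperplaneProj (p • v + q • a) c₀ - c'⟫ - 2 * ζ i * (q * p * ⟪u i, a⟫) ≤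
      q ^ 2 * ⟪u i, a⟫ ^ 2 := by
  set m := p • v + q • a with hm
  have hm1 : ‖m‖ = 1 := norm_smul_add_smul_eq_one hv ha hva hpq
  set e := hyperplaneProj m c₀ - c' with he
  have hem : ⟪e, m⟫ = 0 := by
    rw [he, inner_sub_left, inner_hyperplaneProj_self hm1, hc', sub_zero]
  have hum : ⟪u i, m⟫ = q * ⟪u i, a⟫ := by
    rw [hm, inner_add_right, inner_smul_right, inner_smul_right, hs.inner_eq]; ring
  have hvm : ⟪v, m⟫ = p := by
    rw [hm, inner_add_right, inner_smul_right, inner_smul_right, real_inner_self_eq_norm_sq, hv,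
      real_inner_comm, hva]; ring
  have h1 := h ⟨_, hs.mem i, rfl⟩
  have h2 : hyperplaneProj m (c₀ + u i + ζ i • v) - c' =
      hyperplaneProj m (u i) + hyperplaneProj m (e + ζ i • v) := by
    rw [hyperplaneProj_add, hyperplaneProj_add, hyperplaneProj_add,
      hyperplaneProj_of_inner_eq_zero hem, he]
    abel
  rw [mem_closedBall, dist_eq_norm, h2] at h1
  have h3 : ‖hyperplaneProj m (u i) + hyperplaneProj m (e + ζ i • v)‖ ^ 2 ≤ R ^ 2 := by gcongr
  rw [norm_add_sq_real, norm_hyperplaneProj_sq hm1, hs.norm_eq, hum,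
    inner_hyperplaneProj_comm,
    hyperplaneProj_of_inner_eq_zero (inner_hyperplaneProj_self hm1 (e + ζ i • v)),
    hyperplaneProj_add, hyperplaneProj_of_inner_eq_zero hem, inner_add_right,
    ← inner_hyperplaneProj_comm, inner_smul_right, hyperplaneProj, inner_sub_left,
    inner_smul_left, hs.inner_eq, hum, real_inner_comm v m, hvm] at h3
  simp only [RCLike.conj_to_real] at h3
  nlinarith [sq_nonneg ‖e + hyperplaneProj m (ζ i • v)‖]

theorem eq_zero_of_forall_mul_le_sq_mul {X Y : ℝ} (h : ∀ s : ℝ, s * X ≤ s ^ 2 * Y) : X = 0 := by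
  by_contra hX
  have h1 := h (X / (|Y| + 1))
  have h0 : 0 < |Y| + 1 := by positivity
  have h2 : 0 < X ^ 2 := by positivity
  rw [div_mul_eq_mul_div, div_pow, div_mul_eq_mul_div, div_le_div_iff₀ h0 (by positivity)] at h1
  nlinarith [le_abs_self Y, mul_pos h2 h0, mul_pos (mul_pos h2 h0) h0]

theorem IsContactSystem.exists_heights_eq (hs : IsContactSystem B v c₀ R u ζ w) (hv : ‖v‖ = 1)
    (hc : ∀ m : E, ‖m‖ = 1 → ∃ c' : E, hyperplaneProj m '' B ⊆ closedBall c' R ∧ ⟪c', m⟫ = 0) :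
    ∃ S, ∀ i, ζ i = S := by
  have key : ∀ a : E, ‖a‖ = 1 → ⟪a, v⟫ = 0 → ⟪∑ i, (w i * ζ i) • u i, a⟫ = 0 := by
    intro a ha hva
    have hX : ⟪∑ i, (w i * ζ i) • u i, a⟫ = ∑ i, w i * (ζ i * ⟪u i, a⟫) := by
      simp only [sum_inner, real_inner_smul_left, mul_assoc]
    rw [hX]
    suffices - 2 * ∑ i, w i * (ζ i * ⟪u i, a⟫) = 0 by linarith
    refine eq_zero_of_forall_mul_le_sq_mul (Y := ∑ i, w i * ⟪u i, a⟫ ^ 2) fun s => ?_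
    set r := √(1 + s ^ 2) with hr
    have hr0 : 0 < r := by positivity
    have hr2 : r ^ 2 = 1 + s ^ 2 := Real.sq_sqrt (by positivity)
    have hpq : (1 / r) ^ 2 + (s / r) ^ 2 = 1 := by field_simp; exact hr2.symm
    obtain ⟨c', hc'B, hc'⟩ := hc _ (norm_smul_add_smul_eq_one hv ha hva hpq)
    have h1 := fun i => mul_le_mul_of_nonneg_left
      (hs.inner_rotate_le hv ha hva hpq hc'B hc' i) (hs.pos i).le
    have h2 := Finset.sum_le_sum fun i (_ : i ∈ Finset.univ) => h1 i
    have h3 : ∀ i, w i * (2 * ⟪u i, hyperplaneProj ((1 / r) • v + (s / r) • a) c₀ - c'⟫ -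
        2 * ζ i * (s / r * (1 / r) * ⟪u i, a⟫)) =
        2 * (w i * ⟪u i, hyperplaneProj ((1 / r) • v + (s / r) • a) c₀ - c'⟫) +
        (s / r ^ 2) * (-2 * (w i * (ζ i * ⟪u i, a⟫))) := fun i => by field_simp; ring
    have h4 : ∀ i, w i * ((s / r) ^ 2 * ⟪u i, a⟫ ^ 2) =
        (s ^ 2 / r ^ 2) * (w i * ⟪u i, a⟫ ^ 2) := fun i => by ring
    simp only [h3, h4, Finset.sum_add_distrib, ← Finset.mul_sum, hs.sum_mul_inner] at h2
    rw [mul_zero, zero_add, div_mul_eq_mul_div, div_mul_eq_mul_div,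
      div_le_div_iff_of_pos_right (by positivity)] at h2
    exact h2
  have hz : ∑ i, (w i * ζ i) • u i = 0 := by
    by_contra hne
    set y := ∑ i, (w i * ζ i) • u i with hy
    have hyv : ⟪y, v⟫ = 0 := by
      simp only [hy, sum_inner, real_inner_smul_left, hs.inner_eq, mul_zero, Finset.sum_const_zero]
    have := key (‖y‖⁻¹ • y) (norm_inv_norm_smul hne) (by rw [real_inner_smul_left, hyv, mul_zero])
    rw [inner_smul_right, mul_eq_zero, inv_eq_zero, norm_eq_zero, inner_self_eq_zero] at this
    exact hne (this.elim id id)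
  obtain ⟨S, hS⟩ := hs.unique _ hz
  refine ⟨S, fun i => mul_left_cancel₀ (hs.pos i).ne' ?_⟩
  rw [hS, mul_comm]

theorem IsContactSystem.abs_inner_center_sub_le (hs : IsContactSystem B v c₀ R u ζ w)
    (hv : ‖v‖ = 1) {S : ℝ} (hS : ∀ i, ζ i = S) {z : E} {β : ι → ℝ} (hz : ∑ i, β i • u i = z)
    {a : E} (ha : ‖a‖ = 1) (hva : ⟪a, v⟫ = 0) (hza : ⟪z, a⟫ = 0) {p q : ℝ}
    (hpq : p ^ 2 + q ^ 2 = 1) {c' : E}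
    (h : hyperplaneProj (p • v + q • a) '' B ⊆ closedBall c' R)
    (hc' : ⟪c', p • v + q • a⟫ = 0) :
    |⟪z, c'⟫ - ⟪z, c₀⟫| ≤ (∑ i, |β i| * (R ^ 2 / w i)) * q ^ 2 := by
  set m := p • v + q • a with hm
  set g := hyperplaneProj m c₀ - c' - (S * (q * p)) • a with hg
  have hug : ∀ i, ⟪u i, g⟫ ≤ R ^ 2 * q ^ 2 := by
    intro i
    have h1 := hs.inner_rotate_le hv ha hva hpq h hc' i
    have h2 := abs_real_inner_le_norm (u i) a
    rw [hs.norm_eq, ha, mul_one] at h2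
    have h3 : ⟪u i, a⟫ ^ 2 ≤ R ^ 2 := sq_le_sq' (by linarith [neg_abs_le ⟪u i, a⟫])
      ((le_abs_self _).trans h2)
    rw [hS] at h1
    have h4 := mul_le_mul_of_nonneg_left h3 (sq_nonneg q)
    rw [hg, inner_sub_right, inner_smul_right]
    nlinarith [mul_nonneg (sq_nonneg R) (sq_nonneg q)]
  have hw1 : ∀ i, w i ≤ 1 := fun i => by
    rw [← hs.sum_eq_one]
    exact Finset.single_le_sum (fun j _ => (hs.pos j).le) (Finset.mem_univ i)
  have hM : 0 ≤ R ^ 2 * q ^ 2 := by positivity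
  have habs : ∀ i, |⟪u i, g⟫| ≤ R ^ 2 / w i * q ^ 2 := by
    intro i
    have h1 : w i * (R ^ 2 * q ^ 2 - ⟪u i, g⟫) ≤ R ^ 2 * q ^ 2 := by
      have h2 : ∑ j, w j * (R ^ 2 * q ^ 2 - ⟪u j, g⟫) = R ^ 2 * q ^ 2 := by
        simp only [mul_sub, Finset.sum_sub_distrib, hs.sum_mul_inner, ← Finset.sum_mul,
          hs.sum_eq_one]
        ring
      refine le_trans ?_ h2.le
      exact Finset.single_le_sum (f := fun j => w j * (R ^ 2 * q ^ 2 - ⟪u j, g⟫))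
        (fun j _ => mul_nonneg (hs.pos j).le (sub_nonneg.mpr (hug j))) (Finset.mem_univ i)
    have h2 := mul_le_mul_of_nonneg_left (hug i) (hs.pos i).le
    have h3 := mul_le_mul_of_nonneg_right (hw1 i) hM
    have h4 := mul_nonneg (hs.pos i).le hM
    rw [div_mul_eq_mul_div, le_div_iff₀ (hs.pos i), mul_comm, ← abs_of_pos (hs.pos i), ← abs_mul,
      abs_le]
    constructor <;> linarith
  have hzg : ⟪z, g⟫ = ⟪z, c₀⟫ - ⟪z, c'⟫ := by
    have hzv : ⟪z, v⟫ = 0 := by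
      simp only [← hz, sum_inner, real_inner_smul_left, hs.inner_eq, mul_zero,
        Finset.sum_const_zero]
    have hzm : ⟪z, m⟫ = 0 := by
      rw [hm, inner_add_right, inner_smul_right, inner_smul_right, hza, hzv]; ring
    rw [hg, inner_sub_right, inner_sub_right, ← inner_hyperplaneProj_comm,
      hyperplaneProj_of_inner_eq_zero hzm, inner_smul_right, hza]
    ring
  rw [abs_sub_comm, ← hzg, ← hz, sum_inner, Finset.sum_mul]
  refine (Finset.abs_sum_le_sum_abs _ _).trans (Finset.sum_le_sum fun i _ => ?_)
  rw [real_inner_smul_left, abs_mul, mul_assoc]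
  exact mul_le_mul_of_nonneg_left (habs i) (abs_nonneg _)

theorem IsContactSystem.exists_sum_eq [FiniteDimensional ℝ E]
    (hs : IsContactSystem B v c₀ R u ζ w) (hv : ‖v‖ = 1)
    (hnd : ∀ y : E, ⟪y, v⟫ = 0 → (∀ i, ⟪u i, y⟫ = 0) → y = 0) {z : E} (hz : ⟪z, v⟫ = 0) :
    ∃ β : ι → ℝ, ∑ i, β i • u i = z := by
  rw [← Submodule.mem_span_range_iff_exists_fun, ← Submodule.orthogonal_orthogonal
    (Submodule.span ℝ (Set.range u)), Submodule.mem_orthogonal]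
  intro y hy
  rw [Submodule.mem_orthogonal] at hy
  have hyu : ∀ i, ⟪u i, y⟫ = 0 := fun i => hy _ (Submodule.subset_span ⟨i, rfl⟩)
  have h0 := hnd (hyperplaneProj v y) (inner_hyperplaneProj_self hv y) fun i => by
    rw [← inner_hyperplaneProj_comm, hyperplaneProj_of_inner_eq_zero (hs.inner_eq i), hyu]
  rw [hyperplaneProj, sub_eq_zero] at h0
  rw [h0, real_inner_smul_left, real_inner_comm z v, hz, mul_zero]

end Nondegenerate

section Centers

theorem eq_of_forall_exists_abs_sub_le_sq {f : ℝ → ℝ}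
    (h : ∀ s, ∃ C, ∀ t, |f t - f s| ≤ C * (t - s) ^ 2) (x y : ℝ) : f x = f y := by
  have hd : ∀ s, HasFDerivAt f (0 : ℝ →L[ℝ] ℝ) s := fun s => by
    obtain ⟨C, hC⟩ := h s
    have : HasFDerivAt (fun t => f t - f s) (0 : ℝ →L[ℝ] ℝ) s := by
      refine Asymptotics.IsBigO.hasFDerivAt (n := 2) (.of_bound C (.of_forall fun t => ?_)) one_lt_two
      simpa using hC t
    simpa using this.add_const (f s)
  exact is_const_of_fderiv_eq_zero (𝕜 := ℝ) (fun s => (hd s).differentiableAt)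
    (fun s => (hd s).fderiv) x y

variable {E : Type*} [NormedAddCommGroup E] [InnerProductSpace ℝ E] [FiniteDimensional ℝ E]

theorem exists_unit_orthogonal_pair (hE : 3 ≤ Module.finrank ℝ E) (x y : E) :
    ∃ v : E, ‖v‖ = 1 ∧ ⟪x, v⟫ = 0 ∧ ⟪y, v⟫ = 0 := by
  classical
  have h1 := Submodule.finrank_add_finrank_orthogonal (Submodule.span ℝ (({x, y} : Finset E) : Set E))
  have h2 := (finrank_span_finset_le_card (R := ℝ) ({x, y} : Finset E)).trans Finset.card_le_two
  have h3 : (Submodule.span ℝ (({x, y} : Finset E) : Set E))ᗮ ≠ ⊥ := by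
    intro h
    rw [h, finrank_bot] at h1
    rw [Set.finrank] at h2
    lia
  obtain ⟨w, hw, hw0⟩ := Submodule.exists_mem_ne_zero_of_ne_bot h3
  rw [Submodule.mem_orthogonal] at hw
  refine ⟨‖w‖⁻¹ • w, norm_inv_norm_smul hw0, ?_, ?_⟩ <;>
    rw [inner_smul_right, hw _ (Submodule.subset_span (by simp)), mul_zero]

variable {B : Set E} {R : ℝ} {c : E → E}

theorem exists_forall_abs_inner_center_sub_le
    (hc : ∀ v, ‖v‖ = 1 → IsCircumball (hyperplaneProj v '' B) (c v) R)
    (hno : ¬ ∃ a : E, ∀ v, ‖v‖ = 1 → c v = hyperplaneProj v a) {v z : E} (hv : ‖v‖ = 1)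
    (hzv : ⟪z, v⟫ = 0) :
    ∃ C, ∀ a : E, ‖a‖ = 1 → ⟪a, v⟫ = 0 → ⟪z, a⟫ = 0 → ∀ p q : ℝ, p ^ 2 + q ^ 2 = 1 →
      |⟪z, c (p • v + q • a)⟫ - ⟪z, c v⟫| ≤ C * q ^ 2 := by
  obtain ⟨ι, _, u, ζ, w, hs⟩ := (hc v hv).exists_isContactSystem hv
  obtain ⟨S, hS⟩ := hs.exists_heights_eq hv fun m hm =>
    ⟨c m, (hc m hm).1, (hc m hm).inner_center hm⟩
  obtain ⟨β, hβ⟩ := hs.exists_sum_eq hv (fun y hyv hyu => by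
    by_contra hy
    exact hno (hs.exists_center hv hc hy hyv hyu)) hzv
  refine ⟨∑ i, |β i| * (R ^ 2 / w i), fun a ha hva hza p q hpq => ?_⟩
  have hm := norm_smul_add_smul_eq_one hv ha hva hpq
  exact hs.abs_inner_center_sub_le hv hS hβ ha hva hza hpq (hc _ hm).1 ((hc _ hm).inner_center hm)

theorem inner_center_eq
    (hc : ∀ v, ‖v‖ = 1 → IsCircumball (hyperplaneProj v '' B) (c v) R)
    (hno : ¬ ∃ a : E, ∀ v, ‖v‖ = 1 → c v = hyperplaneProj v a) {v v' z : E} (hv : ‖v‖ = 1)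
    (hv' : ‖v'‖ = 1) (hzv : ⟪z, v⟫ = 0) (hzv' : ⟪z, v'⟫ = 0) : ⟪z, c v⟫ = ⟪z, c v'⟫ := by
  set y := hyperplaneProj v v' with hy
  have hv'y : v' = ⟪v', v⟫ • v + y := by rw [hy, hyperplaneProj]; abel
  have hny : ⟪v', v⟫ ^ 2 + ‖y‖ ^ 2 = 1 := by
    rw [hy, norm_hyperplaneProj_sq hv, hv']; ring
  by_cases hy0 : y = 0
  · rw [hy0, norm_zero] at hny
    have h1 : ⟪v', v⟫ ^ 2 = 1 := by simpa using hny
    rw [hy0, add_zero] at hv'y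
    rcases sq_eq_one_iff.mp h1 with h | h
    · rw [hv'y, h, one_smul]
    · have h2 : v' = -v := by rw [hv'y, h, neg_one_smul]
      have h3 := hc v' hv'
      rw [h2, hyperplaneProj_neg] at h3
      rw [h2, ((hc v hv).unique h3).1]
  set a := ‖y‖⁻¹ • y with ha
  have ha1 : ‖a‖ = 1 := norm_inv_norm_smul hy0
  have hav : ⟪a, v⟫ = 0 := by
    rw [ha, real_inner_smul_left, inner_hyperplaneProj_self hv, mul_zero]
  have hza : ⟪z, a⟫ = 0 := by
    rw [ha, inner_smul_right, hy, hyperplaneProj, inner_sub_right, inner_smul_right, hzv, hzv']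
    ring
  have hconst := eq_of_forall_exists_abs_sub_le_sq
    (f := fun t => ⟪z, c (Real.cos t • v + Real.sin t • a)⟫) (fun s => by
      have hs2 : Real.cos s ^ 2 + Real.sin s ^ 2 = 1 := by rw [add_comm]; exact Real.sin_sq_add_cos_sq s
      obtain ⟨C, hC⟩ := exists_forall_abs_inner_center_sub_le hc hno (z := z)
        (norm_smul_add_smul_eq_one hv ha1 hav hs2)
        (by rw [inner_add_right, inner_smul_right, inner_smul_right, hzv, hza]; ring)
      refine ⟨|C|, fun t => ?_⟩
      have h1 := hC ((-Real.sin s) • v + Real.cos s • a)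
        (norm_smul_add_smul_eq_one hv ha1 hav (by linarith))
        (by
          simp only [inner_add_left, inner_add_right, real_inner_smul_left, inner_smul_right,
            real_inner_self_eq_norm_sq, hv, ha1, hav, real_inner_comm a v]
          ring)
        (by rw [inner_add_right, inner_smul_right, inner_smul_right, hzv, hza]; ring)
        (Real.cos (t - s)) (Real.sin (t - s)) (by rw [add_comm]; exact Real.sin_sq_add_cos_sq _)
      have h2 : Real.cos (t - s) • (Real.cos s • v + Real.sin s • a) +
          Real.sin (t - s) • (-Real.sin s • v + Real.cos s • a) =
          Real.cos t • v + Real.sin t • a := by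
        have hcos : Real.cos t = Real.cos (t - s) * Real.cos s - Real.sin (t - s) * Real.sin s := by
          rw [← Real.cos_add, sub_add_cancel]
        have hsin : Real.sin t = Real.sin (t - s) * Real.cos s + Real.cos (t - s) * Real.sin s := by
          rw [← Real.sin_add, sub_add_cancel]
        rw [hcos, hsin]
        module
      rw [h2] at h1
      refine h1.trans ?_
      have h3 : Real.sin (t - s) ^ 2 ≤ (t - s) ^ 2 := sq_le_sq.mpr Real.abs_sin_le_abs
      exact mul_le_mul (le_abs_self C) h3 (sq_nonneg _) (abs_nonneg C))
  have hle : |⟪v', v⟫| ≤ 1 := by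
    have := abs_real_inner_le_norm v' v
    rwa [hv, hv', mul_one] at this
  have h0 := hconst 0 (Real.arccos ⟪v', v⟫)
  have hsin : √(1 - ⟪v', v⟫ ^ 2) = ‖y‖ := by
    rw [← hny, add_sub_cancel_left, Real.sqrt_sq (norm_nonneg y)]
  simp only [Real.cos_zero, Real.sin_zero, one_smul, zero_smul, add_zero] at h0
  rw [Real.cos_arccos (neg_le_of_abs_le hle) (le_of_abs_le hle), Real.sin_arccos, hsin, ha,
    smul_inv_smul₀ (norm_ne_zero_iff.mpr hy0), ← hv'y] at h0
  exact h0

/-- If the circumballs of all projections of `B` have the same radius, then their centres are the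
projections of a single point. -/
theorem exists_center_eq_hyperplaneProj (hE : 3 ≤ Module.finrank ℝ E)
    (hc : ∀ v, ‖v‖ = 1 → IsCircumball (hyperplaneProj v '' B) (c v) R) :
    ∃ a : E, ∀ v, ‖v‖ = 1 → c v = hyperplaneProj v a := by
  by_contra hno
  refine hno ?_
  choose N hN hzN _ using fun z : E => exists_unit_orthogonal_pair hE z 0
  have hind : ∀ z v : E, ‖v‖ = 1 → ⟪z, v⟫ = 0 → ⟪z, c (N z)⟫ = ⟪z, c v⟫ := fun z v hv hzv =>
    inner_center_eq hc hno (hN z) hv (hzN z) hzv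
  let φ : E →ₗ[ℝ] ℝ :=
    { toFun := fun z => ⟪z, c (N z)⟫
      map_add' := fun x y => by
        obtain ⟨v, hv, hx, hy⟩ := exists_unit_orthogonal_pair hE x y
        rw [hind x v hv hx, hind y v hv hy,
          hind (x + y) v hv (by rw [inner_add_left, hx, hy, add_zero]), inner_add_left]
      map_smul' := fun r x => by
        rw [hind (r • x) (N x) (hN x) (by rw [real_inner_smul_left, hzN, mul_zero]),
          real_inner_smul_left, RingHom.id_apply, smul_eq_mul] }
  refine ⟨(InnerProductSpace.toDual ℝ E).symm φ.toContinuousLinearMap, fun v hv => ?_⟩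
  refine ext_inner_right ℝ fun z => ?_
  rw [inner_hyperplaneProj_comm, InnerProductSpace.toDual_symm_apply,
    ← hyperplaneProj_of_inner_eq_zero ((hc v hv).inner_center hv), inner_hyperplaneProj_comm,
    LinearMap.coe_toContinuousLinearMap']
  change _ = ⟪hyperplaneProj v z, c (N (hyperplaneProj v z))⟫
  rw [hind _ v hv (inner_hyperplaneProj_self hv z), real_inner_comm]

end Centers

section SupportFunction

variable {E : Type*} [NormedAddCommGroup E] [InnerProductSpace ℝ E] {B : Set E}

/-- The support function of `B` relative to the point `a`. -/
noncomputable def supportFunctionAt (B : Set E) (a u : E) : ℝ :=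
  sSup ((fun x => ⟪x - a, u⟫) '' B)

theorem continuous_supportFunctionAt (hB : IsCompact B) (a : E) :
    Continuous (supportFunctionAt B a) :=
  hB.continuous_sSup (f := fun u x => ⟪x - a, u⟫) (by fun_prop)

theorem inner_le_supportFunctionAt (hB : IsCompact B) (a u : E) {x : E} (hx : x ∈ B) :
    ⟪x - a, u⟫ ≤ supportFunctionAt B a u :=
  le_csSup (hB.image (by fun_prop)).bddAbove ⟨x, hx, rfl⟩

theorem eq_zero_of_forall_inner_sub_eq_zero (hB : (interior B).Nonempty) {a y : E}
    (h : ∀ x ∈ B, ⟪x - a, y⟫ = 0) : y = 0 := by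
  obtain ⟨x, hx⟩ := hB
  have hev : ∀ᶠ t : ℝ in nhds 0, x + t • y ∈ interior B :=
    (show ContinuousAt (fun t : ℝ => x + t • y) 0 by fun_prop).eventually_mem
      (by simpa using isOpen_interior.mem_nhds hx)
  obtain ⟨ε, hε, hball⟩ := Metric.eventually_nhds_iff.mp hev
  have h1 := h _ (interior_subset (hball (y := ε / 2)
    (by rw [dist_zero_right, Real.norm_eq_abs, abs_of_pos (by positivity)]; linarith)))
  have h2 := h _ (interior_subset hx)
  rw [add_sub_right_comm, inner_add_left, h2, real_inner_smul_left, zero_add, mul_eq_zero,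
    inner_self_eq_zero] at h1
  exact h1.resolve_left (by positivity)

variable [FiniteDimensional ℝ E]

theorem exists_unitary_supportFunctionAt_eq (hB : (interior B).Nonempty) {a v v' : E}
    (hv : ‖v‖ = 1) (hv' : ‖v'‖ = 1) {f : E ≃ᵢ E}
    (hf : f '' (hyperplaneProj v '' B) = hyperplaneProj v' '' B)
    (hfa : f (hyperplaneProj v a) = hyperplaneProj v' a) :
    ∃ ω : unitary (E →L[ℝ] E), (ω : E →L[ℝ] E) v = v' ∧
      ∀ u, ⟪u, v⟫ = 0 → supportFunctionAt B a ((ω : E →L[ℝ] E) u) = supportFunctionAt B a u := by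
  set L := f.toRealAffineIsometryEquiv.linearIsometryEquiv with hL
  have hLf : ∀ x, L (hyperplaneProj v (x - a)) = f (hyperplaneProj v x) - hyperplaneProj v' a := by
    intro x
    rw [hyperplaneProj_sub, ← hfa]
    exact f.toRealAffineIsometryEquiv.map_vsub _ _
  have himg : (fun x => L (hyperplaneProj v (x - a))) '' B =
      (fun x => hyperplaneProj v' (x - a)) '' B := by
    simp only [hLf]
    simp only [hyperplaneProj_sub]
    have h1 := congrArg (fun s => (fun y => y - hyperplaneProj v' a) '' s) hf
    simpa only [Set.image_image] using h1
  have hLv : hyperplaneProj v' (L v) = 0 := by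
    refine eq_zero_of_forall_inner_sub_eq_zero hB (a := a) fun x hx => ?_
    obtain ⟨x', -, hx'⟩ : hyperplaneProj v' (x - a) ∈
        (fun x => L (hyperplaneProj v (x - a))) '' B := by
      rw [himg]
      exact ⟨x, hx, rfl⟩
    rw [← inner_hyperplaneProj_comm, ← hx', L.inner_map_map, inner_hyperplaneProj_self hv]
  obtain ⟨g, hg, hgx⟩ := exists_unitary_apply_eq (E := E) (v := L v) (w := v')
    (by rw [L.norm_map, hv, hv'])
  have hval : ∀ u, ⟪u, v⟫ = 0 → (g : E →L[ℝ] E) (L u) = L u ∧ ⟪L u, v'⟫ = 0 := by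
    intro u hu
    have h1 : ⟪L u, L v⟫ = 0 := by rw [L.inner_map_map, hu]
    have h2 : ⟪L u, v'⟫ = 0 := by
      rw [hyperplaneProj, sub_eq_zero] at hLv
      rw [hLv, inner_smul_right, mul_eq_zero] at h1
      refine h1.resolve_left fun h0 => ?_
      rw [h0, zero_smul] at hLv
      have := L.norm_map v
      rw [hLv, norm_zero, hv] at this
      exact zero_ne_one this
    exact ⟨hgx _ h1 h2, h2⟩
  refine ⟨g * Unitary.linearIsometryEquiv.symm L, hg, fun u hu => ?_⟩
  change supportFunctionAt B a ((g : E →L[ℝ] E) (L u)) = _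
  obtain ⟨h1, h2⟩ := hval u hu
  rw [h1, supportFunctionAt, supportFunctionAt]
  have h3 : ∀ x, ⟪x - a, L u⟫ = ⟪hyperplaneProj v' (x - a), L u⟫ := fun x => by
    rw [inner_hyperplaneProj_comm, hyperplaneProj_of_inner_eq_zero h2]
  have h4 : ∀ x, ⟪x - a, u⟫ = ⟪L (hyperplaneProj v (x - a)), L u⟫ := fun x => by
    rw [L.inner_map_map, inner_hyperplaneProj_comm, hyperplaneProj_of_inner_eq_zero hu]
  have h5 := congrArg (fun s => (fun y => ⟪y, L u⟫) '' s) himg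
  simp only [Set.image_image] at h5
  simp only [h3, h4, h5]

theorem supportFunctionAt_eq_const_of_congruent (hE : 2 ≤ Module.finrank ℝ E) (hB : IsCompact B)
    {a : E} (hcong : ∀ v v' : E, ‖v‖ = 1 → ‖v'‖ = 1 → ∃ ω : unitary (E →L[ℝ] E),
      (ω : E →L[ℝ] E) v = v' ∧
      ∀ u, ⟪u, v⟫ = 0 → supportFunctionAt B a ((ω : E →L[ℝ] E) u) = supportFunctionAt B a u) :
    ∃ r, ∀ u : E, ‖u‖ = 1 → supportFunctionAt B a u = r := by
  set h := supportFunctionAt B a with hh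
  have hcont : Continuous h := continuous_supportFunctionAt hB a
  have hF : ∀ F : ℝ → ℝ, Continuous F → ∃ C, ∀ u : E, ‖u‖ = 1 → F (h u) + F (h (-u)) = C := by
    intro F hF
    refine Function.Even.exists_eq_const_of_congruent_restrictions hE
      (φ := fun u => F (h u) + F (h (-u))) (fun u => by simp only [neg_neg, add_comm]) (by fun_prop)
      fun v v' hv hv' => ?_
    obtain ⟨ω, hω, hωh⟩ := hcong v v' hv hv'
    refine ⟨ω, hω, fun u hu => ?_⟩
    rw [← map_neg, hωh u hu, hωh (-u) (by rw [inner_neg_left, hu, neg_zero])]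
  obtain ⟨C₁, h1⟩ := hF id continuous_id
  obtain ⟨C₂, h2⟩ := hF (· ^ 2) (by fun_prop)
  simp only [id_eq] at h1
  have hk : ∀ u : E, ‖u‖ = 1 → (2 * h u - C₁) ^ 2 = 2 * C₂ - C₁ ^ 2 := fun u hu => by
    rw [← h1 u hu, ← h2 u hu]; ring
  obtain ⟨u, hu⟩ : ∃ u : E, ‖u‖ = 1 := by
    have : Nontrivial E := Module.nontrivial_of_finrank_pos (R := ℝ) (by lia)
    exact exists_norm_eq E zero_le_one
  have hrank : 1 < Module.rank ℝ E := by
    rw [← Module.finrank_eq_rank]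
    exact_mod_cast hE
  have hodd : ∀ u : E, ‖u‖ = 1 → 2 * h (-u) - C₁ = -(2 * h u - C₁) := fun u hu => by
    rw [← h1 u hu]; ring
  obtain ⟨u₀, hu₀, hk₀⟩ : ∃ u₀ : E, ‖u₀‖ = 1 ∧ 2 * h u₀ - C₁ = 0 := by
    have hconn := isPreconnected_sphere hrank (0 : E) 1
    have hc : ContinuousOn (fun u => 2 * h u - C₁) (sphere (0 : E) 1) := by fun_prop
    have hm : u ∈ sphere (0 : E) 1 := by simpa using hu
    have hm' : -u ∈ sphere (0 : E) 1 := by simpa using hu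
    rcases le_total (2 * h u - C₁) 0 with hle | hle
    · obtain ⟨u₀, hu₀, hk₀⟩ := hconn.intermediate_value hm hm' hc
        ⟨hle, by simp only [hodd u hu]; linarith⟩
      exact ⟨u₀, by simpa using hu₀, hk₀⟩
    · obtain ⟨u₀, hu₀, hk₀⟩ := hconn.intermediate_value hm' hm hc
        ⟨by simp only [hodd u hu]; linarith, hle⟩
      exact ⟨u₀, by simpa using hu₀, hk₀⟩
  refine ⟨C₁ / 2, fun u hu => ?_⟩
  have h3 := hk u hu
  rw [← hk u₀ hu₀, hk₀, zero_pow two_ne_zero, pow_eq_zero_iff two_ne_zero] at h3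
  linarith

theorem eq_closedBall_of_supportFunctionAt_eq (hB : IsCompact B) (hconv : Convex ℝ B)
    (hne : B.Nonempty) {e : E} (he : ‖e‖ = 1) {a : E} {r : ℝ}
    (h : ∀ u : E, ‖u‖ = 1 → supportFunctionAt B a u = r) :
    B = closedBall a r := by
  refine Set.Subset.antisymm (fun x hx => ?_) (fun y hy => ?_)
  · rw [mem_closedBall, dist_eq_norm]
    by_contra! hlt
    rcases eq_or_ne (x - a) 0 with h0 | h0
    · have h1 := inner_le_supportFunctionAt hB a e hx
      rw [h e he, h0, inner_zero_left] at h1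
      rw [h0, norm_zero] at hlt
      linarith
    · have h1 := inner_le_supportFunctionAt hB a (‖x - a‖⁻¹ • (x - a)) hx
      rw [h _ (norm_inv_norm_smul h0), inner_smul_right, real_inner_self_eq_norm_sq, sq,
        inv_mul_cancel_left₀ (norm_ne_zero_iff.mpr h0)] at h1
      linarith
  · by_contra hyB
    obtain ⟨f, s, hf, hs⟩ := geometric_hahn_banach_closed_point hconv hB.isClosed hyB
    set d := (InnerProductSpace.toDual ℝ E).symm f with hd
    have hfd : ∀ x, f x = ⟪x, d⟫ := fun x => by
      rw [real_inner_comm, hd, InnerProductSpace.toDual_symm_apply]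
    simp only [hfd] at hf hs
    have hd0 : d ≠ 0 := by
      intro h0
      obtain ⟨b, hb⟩ := hne
      have := (hf b hb).trans hs
      simp [h0] at this
    have hpos : 0 < ‖d‖⁻¹ := inv_pos.mpr (norm_pos_iff.mpr hd0)
    have hu := norm_inv_norm_smul hd0
    have h1 : supportFunctionAt B a (‖d‖⁻¹ • d) ≤ ‖d‖⁻¹ * (s - ⟪a, d⟫) := by
      refine csSup_le (hne.image _) ?_
      rintro _ ⟨b, hb, rfl⟩
      simp only [inner_smul_right, inner_sub_left]
      have := hf b hb
      gcongr
    rw [h _ hu] at h1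
    have h2 := real_inner_le_norm (y - a) (‖d‖⁻¹ • d)
    rw [hu, mul_one, inner_smul_right, inner_sub_left] at h2
    rw [mem_closedBall, dist_eq_norm] at hy
    have h3 : ‖d‖⁻¹ * (s - ⟪a, d⟫) < ‖d‖⁻¹ * (⟪y, d⟫ - ⟪a, d⟫) := by gcongr
    linarith

end SupportFunction

theorem exists_eq_closedBall_of_congruent_hyperplaneProj {E : Type*} [NormedAddCommGroup E]
    [InnerProductSpace ℝ E] [FiniteDimensional ℝ E] (hE : 3 ≤ Module.finrank ℝ E) {B : Set E}
    (hB : IsCompact B) (hconv : Convex ℝ B) (hint : (interior B).Nonempty)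
    (hproj : ∀ u v : E, ‖u‖ = 1 → ‖v‖ = 1 →
      ∃ f : E ≃ᵢ E, f '' (hyperplaneProj u '' B) = hyperplaneProj v '' B) :
    ∃ (c : E) (r : ℝ), 0 < r ∧ B = closedBall c r := by
  have hne : B.Nonempty := hint.mono interior_subset
  choose c ρ hc using fun v : E => exists_isCircumball
    (hB.image (f := hyperplaneProj v) (by unfold hyperplaneProj; fun_prop)) (hne.image _)
  obtain ⟨e, he, -⟩ := exists_unit_orthogonal_pair hE 0 0
  have hρ : ∀ v, ‖v‖ = 1 → IsCircumball (hyperplaneProj v '' B) (c v) (ρ e) := fun v hv => by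
    obtain ⟨f, hf⟩ := hproj e v he hv
    have h1 := (hc e).image f
    rw [hf] at h1
    rw [(h1.unique (hc v)).2]
    exact hc v
  obtain ⟨a, ha⟩ := exists_center_eq_hyperplaneProj hE hρ
  obtain ⟨r, hr⟩ := supportFunctionAt_eq_const_of_congruent (by lia) hB (a := a)
    fun v v' hv hv' => by
      obtain ⟨f, hf⟩ := hproj v v' hv hv'
      refine exists_unitary_supportFunctionAt_eq hint hv hv' hf ?_
      have h1 := (hc v).image f
      rw [hf] at h1
      rw [← ha v hv, ← ha v' hv', (h1.unique (hc v')).1]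
  have hBr := eq_closedBall_of_supportFunctionAt_eq hB hconv hne he hr
  refine ⟨a, r, ?_, hBr⟩
  by_contra! hr0
  have h0 : e = 0 := eq_zero_of_forall_inner_sub_eq_zero hint (a := a) fun x hx => by
    rw [hBr, mem_closedBall] at hx
    rw [dist_le_zero.mp (hx.trans hr0), sub_self, inner_zero_left]
  rw [h0, norm_zero] at he
  exact zero_ne_one he

/-- if all orthogonal projections onto linear hyperplanes of a convex body
`B ⊆ ℝ^{n+1}` are congruent, then `B` is a closed Euclidean ball.  For a unit vector `v`,
the orthogonal projection onto the hyperplane `v^⊥` is the map `x ↦ x - ⟪x, v⟫ v`. -/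
theorem congruent_projections_implies_ball
    (n : ℕ) (hn : 2 ≤ n)
    (B : Set (EuclideanSpace ℝ (Fin (n + 1))))
    (hBcompact : IsCompact B) (hBconv : Convex ℝ B) (hBint : (interior B).Nonempty)
    (hproj : ∀ u v : EuclideanSpace ℝ (Fin (n + 1)), ‖u‖ = 1 → ‖v‖ = 1 →
      ∃ f : EuclideanSpace ℝ (Fin (n + 1)) ≃ᵢ EuclideanSpace ℝ (Fin (n + 1)),
        f '' ((fun x => x - ⟪x, u⟫ • u) '' B) = (fun x => x - ⟪x, v⟫ • v) '' B) :
    ∃ (c : EuclideanSpace ℝ (Fin (n + 1))) (r : ℝ), 0 < r ∧ B = closedBall c r := by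
  exact exists_eq_closedBall_of_congruent_hyperplaneProj
    (by rw [finrank_euclideanSpace_fin]; lia) hBcompact hBconv hBint hproj
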